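/- Let q ≥ 3 be a prime power, h ≥ 1 an integer, and l ≥ 1 an integer. Then the minimum distance satisfies d(q, (h+1)·l, h) = (q^{h+1} − 1)/(q − 1). -/

import Mathlib

/-- Base-`q` weight of a natural number: the number of nonzero digits in its
base-`q` expansion. -/
def wtq (q a : ℕ) : ℕ := ((Nat.digits q a).filter (fun d => d ≠ 0)).length

/-- `I(q,m,h)`: the set of integers `a` with `1 ≤ a ≤ q^m - 2` whose base-`q`
weight is at most `h`. -/
def Iset (q m h : ℕ) : Set ℕ := {a | 1 ≤ a ∧ a ≤ q ^ m - 2 ∧ wtq q a ≤ h}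

/-- Hamming weight of a coefficient vector: the number of nonzero coordinates. -/
noncomputable def hwt {R : Type*} [Zero R] {n : ℕ} (c : Fin n → R) : ℕ :=
  Set.ncard {i | c i ≠ 0}

/-- Membership in the code `Ω(q,m,h)` with respect to the primitive element `α`
of `L = F_{q^m}`: the polynomial `c(x) = ∑ c_i x^i` (coefficients in `K = F_q`)
vanishes at `α^a` for all `a ∈ I(q,m,h)`. -/
def inOmega {K L : Type*} [Field K] [Field L] [Algebra K L] (q m h : ℕ) (α : L)
    (c : Fin (q ^ m - 1) → K) : Prop :=
  ∀ a ∈ Iset q m h, ∑ i, algebraMap K L (c i) * α ^ (a * (i : ℕ)) = 0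

/-- Membership in the code `Ω̄(q,m,h)` with respect to the primitive element `α`
of `L = F_{q^m}`: the polynomial `c(x) = ∑ c_i x^i` (coefficients in `K = F_q`)
vanishes at `1` and at `α^a` and `α^{-a}` for all `a ∈ I(q,m,h)`. -/
def inOmegaBar {K L : Type*} [Field K] [Field L] [Algebra K L] (q m h : ℕ) (α : L)
    (c : Fin (q ^ m - 1) → K) : Prop :=
  (∑ i, algebraMap K L (c i) = 0) ∧
  ∀ a ∈ Iset q m h,
    (∑ i, algebraMap K L (c i) * α ^ (a * (i : ℕ)) = 0) ∧
    (∑ i, algebraMap K L (c i) * α⁻¹ ^ (a * (i : ℕ)) = 0)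

/-- The recursion for the base-`q` weight: split off the last digit. -/
theorem wtq_eq_add_div {q : ℕ} (hq : 2 ≤ q) (a : ℕ) :
    wtq q a = (if a % q = 0 then 0 else 1) + wtq q (a / q) := by
  rcases Nat.eq_zero_or_pos a with rfl | ha
  · simp [wtq]
  · unfold wtq
    rw [Nat.digits_def' (by omega) ha, List.filter_cons]
    split_ifs <;> simp_all [add_comm]

theorem wtq_zero (q : ℕ) : wtq q 0 = 0 := by simp [wtq]

theorem wtq_mul_add {q : ℕ} (hq : 2 ≤ q) (a : ℕ) {r : ℕ} (hr : r < q) :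
    wtq q (q * a + r) = (if r = 0 then 0 else 1) + wtq q a := by
  rw [wtq_eq_add_div hq, Nat.mul_add_mod, Nat.mod_eq_of_lt hr, Nat.mul_add_div (by omega),
    Nat.div_eq_of_lt hr, add_zero]

theorem wtq_le_of_lt_pow {q : ℕ} (hq : 2 ≤ q) (k : ℕ) :
    ∀ a, a < q ^ k → wtq q a ≤ k := by
  induction k with
  | zero => intro a ha; obtain rfl : a = 0 := by simpa using ha
            simp [wtq_zero]
  | succ k ih =>
    intro a ha
    have := ih (a / q) (Nat.div_lt_of_lt_mul (by rwa [← pow_succ']))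
    rw [wtq_eq_add_div hq]
    split_ifs <;> omega

theorem geomSum_lt_pow {q : ℕ} (hq : 2 ≤ q) (k : ℕ) : ∑ i ∈ Finset.range k, q ^ i < q ^ k :=
  Nat.geomSum_lt hq (by simp)

theorem geomSum_succ_eq (q k : ℕ) :
    ∑ i ∈ Finset.range (k + 1), q ^ i = q * ∑ i ∈ Finset.range k, q ^ i + 1 :=
  geom_sum_succ

/-- The repunit with `h + 1` digits is the least number of weight exceeding `h`. -/
theorem wtq_le_of_lt_geomSum {q : ℕ} (hq : 2 ≤ q) (h : ℕ) :
    ∀ a, a < ∑ i ∈ Finset.range (h + 1), q ^ i → wtq q a ≤ h := by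
  induction h with
  | zero => intro a ha; obtain rfl : a = 0 := by simpa using ha
            simp [wtq_zero]
  | succ h ih =>
    intro a ha
    rw [geomSum_succ_eq] at ha
    have hdm := Nat.div_add_mod a q
    rw [wtq_eq_add_div hq]
    split_ifs with h0
    · have h1 : a / q ≤ ∑ i ∈ Finset.range (h + 1), q ^ i :=
        Nat.div_le_of_le_mul (by omega)
      have := wtq_le_of_lt_pow hq (h + 1) _ (h1.trans_lt (geomSum_lt_pow hq _))
      omega
    · have h1 : a / q < ∑ i ∈ Finset.range (h + 1), q ^ i :=
        lt_of_mul_lt_mul_left (a := q) (by omega) (by omega)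
      have := ih _ h1
      omega

theorem wtq_add_add_le {q : ℕ} (hq : 2 ≤ q) (x : ℕ) :
    ∀ y c, c ≤ 1 → wtq q (x + y + c) ≤ wtq q x + wtq q y + c := by
  suffices H : ∀ s x y c, c ≤ 1 → x + y ≤ s → wtq q (x + y + c) ≤ wtq q x + wtq q y + c from
    fun y c hc => H _ x y c hc le_rfl
  intro s
  induction s using Nat.strong_induction_on with
  | _ s ih =>
  intro x y c hc hs
  rcases Nat.eq_zero_or_pos (x + y) with h0 | hpos
  · obtain ⟨rfl, rfl⟩ : x = 0 ∧ y = 0 := by omega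
    have := wtq_le_of_lt_pow hq c (0 + 0 + c) (by simpa using Nat.lt_pow_self (by omega))
    omega
  have hx := Nat.div_add_mod x q
  have hy := Nat.div_add_mod y q
  have hr := Nat.mod_lt x (show 0 < q by omega)
  have hs' := Nat.mod_lt y (show 0 < q by omega)
  have hlt : x / q + y / q < x + y := by
    have h1 := Nat.div_le_self x q
    have h2 := Nat.div_le_self y q
    rcases Nat.eq_zero_or_pos x with hx0 | hx0
    · have := Nat.div_lt_self (show 0 < y by omega) (show 1 < q by omega)
      omega
    · have := Nat.div_lt_self hx0 (show 1 < q by omega)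
      omega
  rw [wtq_eq_add_div hq x, wtq_eq_add_div hq y]
  generalize x / q = x' at *
  generalize y / q = y' at *
  generalize x % q = r at *
  generalize y % q = t at *
  by_cases hcarry : r + t + c < q
  · have e : x + y + c = q * (x' + y') + (r + t + c) := by rw [← hx, ← hy]; ring
    have := ih (x' + y') (by omega) x' y' 0 (by omega) le_rfl
    rw [e, wtq_mul_add hq _ hcarry]
    rw [add_zero] at this
    split_ifs <;> omega
  · obtain ⟨u, hu⟩ : ∃ u, r + t + c = q + u := Nat.exists_eq_add_of_le (by omega)
    have e : x + y + c = q * (x' + y' + 1) + u := by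
      rw [← hx, ← hy]
      linarith
    have := ih (x' + y') (by omega) x' y' 1 le_rfl le_rfl
    rw [e, wtq_mul_add hq _ (by omega)]
    split_ifs <;> omega

theorem wtq_add_le {q : ℕ} (hq : 2 ≤ q) (x y : ℕ) : wtq q (x + y) ≤ wtq q x + wtq q y :=
  wtq_add_add_le hq x y 0 (by omega)

theorem wtq_pow_mul_add {q : ℕ} (hq : 2 ≤ q) (k : ℕ) :
    ∀ x y, y < q ^ k → wtq q (q ^ k * x + y) = wtq q x + wtq q y := by
  induction k with
  | zero => intro x y hy; obtain rfl : y = 0 := by simpa using hy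
            simp [wtq_zero]
  | succ k ih =>
    intro x y hy
    have hr := Nat.mod_lt y (show 0 < q by omega)
    have e : q ^ (k + 1) * x + y = q * (q ^ k * x + y / q) + y % q := by
      conv_lhs => rw [← Nat.div_add_mod y q]
      ring
    rw [e, wtq_mul_add hq _ hr, ih _ _ (Nat.div_lt_of_lt_mul (by rwa [← pow_succ'])),
      wtq_eq_add_div hq y]
    omega

theorem wtq_mul_geomSum {q j : ℕ} (hq : 2 ≤ q) (hj : 0 < j) (hjq : j < q) (k : ℕ) :
    wtq q (j * ∑ i ∈ Finset.range k, q ^ i) = k := by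
  induction k with
  | zero => simp [wtq_zero]
  | succ k ih =>
    have e : j * (q * ∑ i ∈ Finset.range k, q ^ i + 1)
        = q * (j * ∑ i ∈ Finset.range k, q ^ i) + j := by ring
    rw [geomSum_succ_eq, e, wtq_mul_add hq _ hjq, ih, if_neg hj.ne', add_comm]

theorem geomSum_mul_pred_add_one {q : ℕ} (hq : 2 ≤ q) (k : ℕ) :
    (∑ i ∈ Finset.range k, q ^ i) * (q - 1) + 1 = q ^ k := by
  obtain ⟨p, rfl⟩ : ∃ p, q = p + 1 := ⟨q - 1, by omega⟩
  simpa using geom_sum_mul_add p k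

/-- A positive multiple of the repunit with `k` digits has weight at least `k`. -/
theorem le_wtq_of_geomSum_dvd {q k : ℕ} (hq : 2 ≤ q) (hk : 0 < k) (a : ℕ) (ha : 0 < a)
    (hdvd : ∑ i ∈ Finset.range k, q ^ i ∣ a) : k ≤ wtq q a := by
  induction a using Nat.strong_induction_on with
  | _ a ih =>
  have hG := geomSum_mul_pred_add_one hq k
  have hQ : 1 < q ^ k := Nat.one_lt_pow hk.ne' (by omega)
  have hdm := Nat.div_add_mod a (q ^ k)
  have hmod := Nat.mod_lt a (show 0 < q ^ k by omega)
  by_cases hlt : a < q ^ k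
  · obtain ⟨j, rfl⟩ := hdvd
    have hj : 0 < j := Nat.pos_of_mul_pos_left ha
    have hjq : j ≤ q - 1 := by
      refine le_of_mul_le_mul_left (a := ∑ i ∈ Finset.range k, q ^ i) (by omega) ?_
      exact Nat.pos_of_mul_pos_right ha
    rw [mul_comm, wtq_mul_geomSum hq hj (by omega)]
  · have hdiv : 0 < a / q ^ k := Nat.div_pos (by omega) (by omega)
    have hlt' : a / q ^ k + a % q ^ k < a := by nlinarith
    have e : a = (a / q ^ k + a % q ^ k)
        + (∑ i ∈ Finset.range k, q ^ i) * ((q - 1) * (a / q ^ k)) := by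
      conv_lhs => rw [← hdm]
      rw [← mul_assoc]
      generalize (∑ i ∈ Finset.range k, q ^ i) * (q - 1) = P at *
      rw [← hG]
      ring
    have hd : ∑ i ∈ Finset.range k, q ^ i ∣ a / q ^ k + a % q ^ k := by
      rw [e] at hdvd
      exact (Nat.dvd_add_left (dvd_mul_right _ _)).1 hdvd
    have h1 := ih _ hlt' (Nat.add_pos_left hdiv _) hd
    have h2 := wtq_add_le hq (a / q ^ k) (a % q ^ k)
    have h3 := wtq_pow_mul_add hq k (a / q ^ k) _ hmod
    rw [hdm] at h3
    omega

/-- The BCH bound, for zeros at exponents `1, …, δ - 1` and arbitrary evaluation points. -/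
theorem le_card_support_of_sum_pow_eq_zero {ι L : Type*} [Fintype ι] [Field L] {δ : ℕ}
    {d x : ι → L} (hx : Function.Injective x) (hx0 : ∀ i, x i ≠ 0) (hd : d ≠ 0)
    (h : ∀ a, 1 ≤ a → a < δ → ∑ i, d i * x i ^ a = 0) : δ ≤ Set.ncard {i | d i ≠ 0} := by
  classical
  by_contra! hlt
  obtain ⟨i₀, hi₀⟩ := Function.ne_iff.1 hd
  set S : Finset ι := Finset.univ.filter fun i => d i ≠ 0 with hS
  have hcard : Set.ncard {i | d i ≠ 0} = S.card := by
    rw [← Set.ncard_coe_finset]; simp [hS]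
  have hmem : i₀ ∈ S := by simpa [hS] using hi₀
  set P : Polynomial L := ∏ j ∈ S.erase i₀, (Polynomial.X - Polynomial.C (x j)) with hP
  have hdeg : P.natDegree + 1 = S.card := by
    rw [hP, Polynomial.natDegree_finsetProd_X_sub_C_eq_card, Finset.card_erase_add_one hmem]
  have hzero : ∑ i, d i * x i * P.eval (x i) = 0 := by
    simp_rw [Polynomial.eval_eq_sum_range, Finset.mul_sum]
    rw [Finset.sum_comm]
    refine Finset.sum_eq_zero fun b hb => ?_
    have := h (b + 1) (by omega) (by have := Finset.mem_range.1 hb; omega)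
    rw [← mul_zero (P.coeff b), ← this, Finset.mul_sum]
    exact Finset.sum_congr rfl fun i _ => by ring
  rw [Finset.sum_eq_single i₀] at hzero
  · refine mul_ne_zero (mul_ne_zero hi₀ (hx0 i₀)) ?_ hzero
    rw [hP, Polynomial.eval_prod, Finset.prod_ne_zero_iff]
    intro j hj
    simpa [sub_eq_zero] using fun e => (Finset.mem_erase.1 hj).1 (hx e).symm
  · intro i _ hi
    by_cases hdi : d i = 0
    · simp [hdi]
    · rw [hP, Polynomial.eval_prod, Finset.prod_eq_zero (i := i) (by simp [hi, hS, hdi]) (by simp),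
        mul_zero]
  · simp

theorem injective_pow_fin {L : Type*} [Field L] {α : L} {n : ℕ} (hα : orderOf α = n) :
    Function.Injective fun i : Fin n => α ^ (i : ℕ) := by
  intro i j hij
  exact Fin.ext (pow_injOn_Iio_orderOf (by simp [hα]) (by simp [hα]) hij)

theorem geomSum_le_hwt_of_inOmega {K L : Type*} [Field K] [Field L] [Algebra K L]
    {q m h : ℕ} (hq : 2 ≤ q) (hm : h + 1 ≤ m) {α : L} (hα : orderOf α = q ^ m - 1)
    {c : Fin (q ^ m - 1) → K} (hc : c ≠ 0) (hΩ : inOmega q m h α c) :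
    ∑ i ∈ Finset.range (h + 1), q ^ i ≤ hwt c := by
  have hpow : 1 < q ^ m := Nat.one_lt_pow (by omega) (by omega)
  have hα0 : α ≠ 0 := by
    rintro rfl
    rw [orderOf_zero] at hα
    omega
  have hlt := (geomSum_lt_pow hq (h + 1)).trans_le (Nat.pow_le_pow_right (by omega) hm)
  have := le_card_support_of_sum_pow_eq_zero (δ := ∑ i ∈ Finset.range (h + 1), q ^ i)
    (d := fun i => algebraMap K L (c i)) (injective_pow_fin hα) (fun i => pow_ne_zero _ hα0)
    (fun e => hc <| funext fun i => by simpa using congrFun e i) (fun a h1 h2 => by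
      rw [← hΩ a ⟨h1, by omega, wtq_le_of_lt_geomSum hq h a h2⟩]
      exact Finset.sum_congr rfl fun i _ => by rw [← pow_mul, mul_comm a])
  simpa [hwt] using this

/-- The sum of the `a`-th powers over the subgroup of order `N` of a cyclic group of order
`t * N` vanishes unless `N ∣ a`. -/
theorem sum_pow_mul_eq_zero {L : Type*} [Field L] {α : L} {t N a : ℕ} (ht : 0 < t)
    (hα : orderOf α = t * N) (ha : ¬ N ∣ a) : ∑ j : Fin N, α ^ (a * (t * (j : ℕ))) = 0 := by
  have h1 : α ^ (a * t) ≠ 1 := by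
    rw [Ne, ← orderOf_dvd_iff_pow_eq_one, hα, mul_comm a]
    exact fun h => ha (Nat.dvd_of_mul_dvd_mul_left ht h)
  have h2 : (α ^ (a * t)) ^ N = 1 := by
    rw [← pow_mul, mul_assoc, ← hα, mul_comm, pow_mul, pow_orderOf_eq_one, one_pow]
  have h3 := geom_sum_mul (α ^ (a * t)) N
  rw [h2, sub_self, mul_eq_zero, or_iff_left (sub_ne_zero.2 h1)] at h3
  rw [← h3, ← Fin.sum_univ_eq_sum_range (fun j => (α ^ (a * t)) ^ j)]
  exact Finset.sum_congr rfl fun j _ => by rw [← pow_mul, mul_assoc]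

theorem exists_inOmega_hwt_eq_geomSum {K L : Type*} [Field K] [Field L] [Algebra K L]
    {q m h : ℕ} (hq : 2 ≤ q) (hm0 : 0 < m) (hm : h + 1 ∣ m) {α : L}
    (hα : orderOf α = q ^ m - 1) :
    ∃ c : Fin (q ^ m - 1) → K, c ≠ 0 ∧ inOmega q m h α c ∧
      hwt c = ∑ i ∈ Finset.range (h + 1), q ^ i := by
  classical
  have hG := geomSum_mul_pred_add_one hq (h + 1)
  have hdvd : ∑ i ∈ Finset.range (h + 1), q ^ i ∣ q ^ m - 1 := by
    refine dvd_trans ⟨q - 1, ?_⟩ (Nat.pow_sub_one_dvd_pow_sub_one q hm)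
    omega
  have hpow : 1 < q ^ m := Nat.one_lt_pow (by omega) (by omega)
  have hN0 : 0 < ∑ i ∈ Finset.range (h + 1), q ^ i := by rw [geomSum_succ_eq]; omega
  have hN := le_wtq_of_geomSum_dvd hq (Nat.succ_pos h)
  simp only [inOmega, Iset, Set.mem_ofPred_eq]
  generalize ∑ i ∈ Finset.range (h + 1), q ^ i = N at *
  obtain ⟨t, ht⟩ := hdvd
  rw [mul_comm] at ht
  have ht0 : 0 < t := Nat.pos_of_ne_zero (by rintro rfl; omega)
  generalize q ^ m - 2 = b
  generalize q ^ m - 1 = n at *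
  subst ht
  let f : Fin N → Fin (t * N) := fun j => ⟨t * j, Nat.mul_lt_mul_of_pos_left j.2 ht0⟩
  have hf : Function.Injective f := fun i j e =>
    Fin.ext (Nat.eq_of_mul_eq_mul_left ht0 (congrArg Fin.val e))
  let c : Fin (t * N) → K := fun i => if i ∈ Set.range f then 1 else 0
  have hsupp : {i | c i ≠ 0} = Set.range f := by ext i; simp [c]
  refine ⟨c, ?_, ?_, ?_⟩
  · intro e
    have := congrFun e (f ⟨0, hN0⟩)
    simp [c] at this
  · rintro a ⟨ha, -, hw⟩
    have hna : ¬ N ∣ a := fun hd => by have := hN a ha hd; omega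
    rw [← sum_pow_mul_eq_zero ht0 hα hna]
    refine (Finset.sum_of_injOn f hf.injOn (by simp) ?_ ?_).symm
    · intro i _ hi
      simp only [Finset.coe_univ, Set.image_univ] at hi
      simp only [c, if_neg hi, map_zero, zero_mul]
    · intro j _
      simp only [c, if_pos (Set.mem_range_self j), map_one, one_mul, f]
  · rw [hwt, hsupp, ← Set.image_univ, Set.ncard_image_of_injective _ hf, Set.ncard_univ,
      Nat.card_fin]


/-- For a prime power `q ≥ 3`, `h ≥ 1` and `l ≥ 1`, the minimum distance of
`Ω(q, (h+1)·l, h)` equals `(q^{h+1} - 1)/(q - 1)`: it is the least Hamming weight of a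
nonzero codeword. -/
theorem stmt5 (q h l : ℕ) (hq : IsPrimePow q) (hq3 : 3 ≤ q) (hh : 1 ≤ h) (hl : 1 ≤ l)
    (K L : Type) [Field K] [Fintype K] [Field L] [Fintype L] [Algebra K L]
    (hcardK : Fintype.card K = q) (hcardL : Fintype.card L = q ^ ((h + 1) * l))
    (α : L) (hα : orderOf α = q ^ ((h + 1) * l) - 1) :
    IsLeast {w | ∃ c : Fin (q ^ ((h + 1) * l) - 1) → K,
        c ≠ 0 ∧ inOmega q ((h + 1) * l) h α c ∧ hwt c = w}
      ((q ^ (h + 1) - 1) / (q - 1)) := by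
  have hq2 : 2 ≤ q := by omega
  rw [← Nat.geomSum_eq hq2]
  have hm : h + 1 ≤ (h + 1) * l := Nat.le_mul_of_pos_right _ hl
  refine ⟨exists_inOmega_hwt_eq_geomSum hq2 (by omega) (dvd_mul_right _ _) hα, ?_⟩
  rintro _ ⟨c, hc, hΩ, rfl⟩
  exact geomSum_le_hwt_of_inOmega hq2 hm hα hc hΩ
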